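/- arXiv:math/0502439 — 3 statements merged into one kernel-verified Lean document; each statement's English description precedes it below -/
import Mathlib

section
/- Let K be an algebraically closed field with char K ∉ {2,3} and let L = Frac(K[a,b,c]) be the field of rational functions in three independent variables a, b, c over K. Set A(s) = 4a³b³((b−a)c·s⁸ + (2ac+2bc+4ab)s⁴ + (b−a)c) and B(s) = 16a⁵b⁵s²((b−a)s⁸ + 2(b+a)s⁴ + (b−a)) in L[s]. Then the discriminant polynomial Δ(s) = −16(4A(s)³ + 27B(s)²) ∈ L[s] has degree exactly 24 and is squarefree (i.e. Δ and its derivative are coprime in L[s]); equivalently, the generic member of this family of elliptic surfaces has exactly 24 singular fibers, all of type I₁. -/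
open Polynomial

/-- The coefficient `A(s) = 4a³b³((b−a)c·s⁸ + (2ac+2bc+4ab)s⁴ + (b−a)c)` as a polynomial
in `s` over `L = Frac(K[a,b,c])`. -/
noncomputable def kuwataA (K : Type) [Field K] :
    Polynomial (FractionRing (MvPolynomial (Fin 3) K)) :=
  letI L := FractionRing (MvPolynomial (Fin 3) K)
  letI a : Polynomial L := C (algebraMap (MvPolynomial (Fin 3) K) L (MvPolynomial.X 0))
  letI b : Polynomial L := C (algebraMap (MvPolynomial (Fin 3) K) L (MvPolynomial.X 1))
  letI c : Polynomial L := C (algebraMap (MvPolynomial (Fin 3) K) L (MvPolynomial.X 2))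
  4 * a ^ 3 * b ^ 3 *
    ((b - a) * c * X ^ 8 + (2 * a * c + 2 * b * c + 4 * a * b) * X ^ 4 + (b - a) * c)

/-- The coefficient `B(s) = 16a⁵b⁵s²((b−a)s⁸ + 2(b+a)s⁴ + (b−a))` as a polynomial
in `s` over `L = Frac(K[a,b,c])`. -/
noncomputable def kuwataB (K : Type) [Field K] :
    Polynomial (FractionRing (MvPolynomial (Fin 3) K)) :=
  letI L := FractionRing (MvPolynomial (Fin 3) K)
  letI a : Polynomial L := C (algebraMap (MvPolynomial (Fin 3) K) L (MvPolynomial.X 0))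
  letI b : Polynomial L := C (algebraMap (MvPolynomial (Fin 3) K) L (MvPolynomial.X 1))
  letI c : Polynomial L := C (algebraMap (MvPolynomial (Fin 3) K) L (MvPolynomial.X 2))
  16 * a ^ 5 * b ^ 5 * X ^ 2 * ((b - a) * X ^ 8 + 2 * (b + a) * X ^ 4 + (b - a))

section DiscriminantOverField

variable {L M : Type*} [Field L] [Field M]

/-- The octic `(b−a)c·s⁸ + (2ac+2bc+4ab)s⁴ + (b−a)c`. -/
private noncomputable def octicP (a b c : L) : L[X] :=
  C ((b - a) * c) * X ^ 8 + C (2 * a * c + 2 * b * c + 4 * a * b) * X ^ 4 + C ((b - a) * c)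

/-- The octic `(b−a)s⁸ + 2(b+a)s⁴ + (b−a)`. -/
private noncomputable def octicQ (a b : L) : L[X] :=
  C (b - a) * X ^ 8 + C (2 * (b + a)) * X ^ 4 + C (b - a)

/-- The discriminant of the family, up to a constant factor. -/
private noncomputable def reducedDisc (a b c : L) : L[X] :=
  octicP a b c ^ 3 + C (27 * a * b) * X ^ 4 * octicQ a b ^ 2

private theorem degree_reducedDisc {a b c : L} (hc : c ≠ 0) (hab : b - a ≠ 0) :
    (reducedDisc a b c).degree = 24 := by
  have hP : (octicP a b c).degree = 8 := by
    unfold octicP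
    compute_degree!
  have hQ : (octicQ a b).degree ≤ 8 := by
    unfold octicQ
    compute_degree
  have hP3 : (octicP a b c ^ 3).degree = 24 := by
    rw [degree_pow, hP]; rfl
  have hR : (C (27 * a * b) * X ^ 4 * octicQ a b ^ 2).degree ≤ 20 := by
    have h1 : (C (27 * a * b) * X ^ 4 : L[X]).degree ≤ 4 := degree_C_mul_X_pow_le _ _
    have h2 : (octicQ a b ^ 2).degree ≤ 16 := degree_pow_le_of_le 2 hQ
    exact degree_mul_le_of_le h1 h2
  rw [reducedDisc, degree_add_eq_left_of_degree_lt, hP3]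
  rw [hP3]
  exact hR.trans_lt (by decide)

/-- With `t = s⁴` and `v = (b−a)(t + 1/t) + 2(a+b)`, the reduced discriminant is
`t³ · ((c v + 4ab)³ + 27ab v²)`; this cubic in `v` is separable, and the branch points
`t = ±1` of `t ↦ v` lie over `v = 4b` and `v = 4a`, which are not roots of it. -/
private theorem no_common_root {x y z s : M} (h2 : (2 : M) ≠ 0) (h3 : (3 : M) ≠ 0)
    (hx : x ≠ 0) (hy : y ≠ 0) (hz : z ≠ 0) (hxy : y - x ≠ 0) (hz1 : z ^ 2 + 1 ≠ 0)
    (hxz : 4 * (x + z) ^ 3 + 27 * x ≠ 0) (hyz : 4 * (y + z) ^ 3 + 27 * y ≠ 0)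
    (h0 : (reducedDisc x y z).eval s = 0) (h1 : (derivative (reducedDisc x y z)).eval s = 0) :
    False := by
  have hs : s ≠ 0 := by
    rintro rfl
    simp [reducedDisc, octicP, hz, hxy] at h0
  obtain ⟨v, hv⟩ : ∃ v, v * s ^ 4 = (y - x) * s ^ 8 + 2 * (y + x) * s ^ 4 + (y - x) :=
    ⟨_, div_mul_cancel₀ _ (pow_ne_zero 4 hs)⟩
  have hP : (octicP x y z).eval s = s ^ 4 * (z * v + 4 * x * y) := by
    simp only [octicP, eval_add, eval_mul, eval_C, eval_pow, eval_X]
    linear_combination -z * hv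
  have hQ : (octicQ x y).eval s = s ^ 4 * v := by
    simp only [octicQ, eval_add, eval_mul, eval_C, eval_pow, eval_X]
    linear_combination -hv
  have hH : (z * v + 4 * x * y) ^ 3 + 27 * x * y * v ^ 2 = 0 := by
    refine (mul_eq_zero.1 (?_ : s ^ 12 * _ = 0)).resolve_left (pow_ne_zero 12 hs)
    simp only [reducedDisc, eval_add, eval_mul, eval_C, eval_pow, eval_X, hP, hQ] at h0
    linear_combination h0
  have hD : (s ^ 8 - 1) * (3 * z * (z * v + 4 * x * y) ^ 2 + 54 * x * y * v) = 0 := by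
    refine (mul_eq_zero.1 (?_ : 2 ^ 2 * s ^ 8 * (y - x) * _ = 0)).resolve_left
      (by simp [h2, hs, hxy])
    have hP' : s * (derivative (octicP x y z)).eval s =
        4 * s ^ 4 * (z * v + 4 * x * y) + 4 * (y - x) * z * (s ^ 8 - 1) := by
      simp [octicP]
      linear_combination -4 * z * hv
    have hQ' : s * (derivative (octicQ x y)).eval s =
        4 * s ^ 4 * v + 4 * (y - x) * (s ^ 8 - 1) := by
      simp [octicQ]
      linear_combination -4 * hv
    simp [reducedDisc, derivative_pow, hP, hQ] at h1
    linear_combination s * h1 - 12 * s ^ 12 * hH - 3 * (s ^ 4 * (z * v + 4 * x * y)) ^ 2 * hP' -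
      54 * x * y * s ^ 8 * v * hQ'
  rcases mul_eq_zero.1 hD with ht | hH'
  · have ht' : (s ^ 4 - 1) * (s ^ 4 + 1) = 0 := by linear_combination ht
    rcases mul_eq_zero.1 ht' with h | h
    · have hv' : v = 4 * y := by
        linear_combination hv + (-v + (y - x) * (s ^ 4 + 1) + 2 * (y + x)) * h
      subst hv'
      have : 2 ^ 4 * y ^ 3 * (4 * (x + z) ^ 3 + 27 * x) = 0 := by linear_combination hH
      exact hxz ((mul_eq_zero.1 this).resolve_left (by simp [h2, hy]))
    · have hv' : v = 4 * x := by
        linear_combination -hv + (v - (y - x) * (s ^ 4 - 1) - 2 * (y + x)) * h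
      subst hv'
      have : 2 ^ 4 * x ^ 3 * (4 * (y + z) ^ 3 + 27 * y) = 0 := by linear_combination hH
      exact hyz ((mul_eq_zero.1 this).resolve_left (by simp [h2, hx]))
  · have hv' : 3 ^ 3 * x * y * v * (8 * x * y - z * v) = 0 := by
      linear_combination (z * v + 4 * x * y) * hH' - 3 * z * hH
    have hv0 : v ≠ 0 := by
      rintro rfl
      have : 2 ^ 6 * x ^ 3 * y ^ 3 = 0 := by linear_combination hH
      simp [h2, hx, hy] at this
    have hzv : 8 * x * y - z * v = 0 :=
      (mul_eq_zero.1 hv').resolve_left (by simp [h3, hx, hy, hv0])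
    have : 2 ^ 6 * 3 ^ 3 * (x * y) ^ 3 * (z ^ 2 + 1) = 0 := by
      have hzv' : z * v = 8 * (x * y) := by linear_combination -hzv
      have hz2H : z ^ 2 * (z * v + 4 * x * y) ^ 3 + 27 * (x * y) * (z * v) ^ 2 = 0 := by
        linear_combination z ^ 2 * hH
      rw [hzv'] at hz2H
      linear_combination hz2H
    exact hz1 ((mul_eq_zero.1 this).resolve_left (by simp [h2, h3, hx, hy]))

private theorem isCoprime_derivative_reducedDisc {a b c : L}
    (h2 : (2 : L) ≠ 0) (h3 : (3 : L) ≠ 0)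
    (ha : a ≠ 0) (hb : b ≠ 0) (hc : c ≠ 0) (hab : b - a ≠ 0) (hc1 : c ^ 2 + 1 ≠ 0)
    (hac : 4 * (a + c) ^ 3 + 27 * a ≠ 0) (hbc : 4 * (b + c) ^ 3 + 27 * b ≠ 0) :
    IsCoprime (reducedDisc a b c) (derivative (reducedDisc a b c)) := by
  rw [isCoprime_iff_aeval_ne_zero_of_isAlgClosed L (AlgebraicClosure L)]
  intro s
  by_contra! h
  have hmap : (reducedDisc a b c).map (algebraMap L (AlgebraicClosure L)) =
      reducedDisc (algebraMap L _ a) (algebraMap L _ b) (algebraMap L _ c) := by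
    simp [reducedDisc, octicP, octicQ, map_ofNat]
  have key {r : L} (hr : r ≠ 0) : algebraMap L (AlgebraicClosure L) r ≠ 0 := by simpa using hr
  refine no_common_root (s := s) (by simpa [map_ofNat] using key h2)
    (by simpa [map_ofNat] using key h3) (key ha) (key hb) (key hc) (by simpa using key hab)
    (by simpa using key hc1) (by simpa [map_ofNat] using key hac)
    (by simpa [map_ofNat] using key hbc) ?_ ?_
  · rw [← hmap, eval_map_algebraMap, h.1]
  · rw [← hmap, derivative_map, eval_map_algebraMap, h.2]

end DiscriminantOverField

section GenericPoint

variable {K L : Type*} [Field K] [Field L] [Algebra (MvPolynomial (Fin 3) K) L]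
  [FaithfulSMul (MvPolynomial (Fin 3) K) L]

private theorem algebraMap_ne_zero_of_eval {p : MvPolynomial (Fin 3) K} (w : Fin 3 → K)
    (h : MvPolynomial.eval w p ≠ 0) : algebraMap (MvPolynomial (Fin 3) K) L p ≠ 0 := by
  rw [Ne, FaithfulSMul.algebraMap_eq_zero_iff]
  rintro rfl
  simp at h

/-- A nonzero scalar times the reduced discriminant at the generic point `(a, b, c)` has degree
`24` and is separable. -/
private theorem degree_and_isCoprime_of_generic (h2 : (2 : K) ≠ 0) (h3 : (3 : K) ≠ 0) {a b c : L}
    (ha : a = algebraMap (MvPolynomial (Fin 3) K) L (MvPolynomial.X 0))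
    (hb : b = algebraMap (MvPolynomial (Fin 3) K) L (MvPolynomial.X 1))
    (hc : c = algebraMap (MvPolynomial (Fin 3) K) L (MvPolynomial.X 2)) {f : L[X]}
    (hf : f = C (-2 ^ 12 * a ^ 9 * b ^ 9) * reducedDisc a b c) :
    f.degree = 24 ∧ IsCoprime f (derivative f) := by
  have ha0 : a ≠ 0 := ha ▸ algebraMap_ne_zero_of_eval ![1, 0, 0] (by simp)
  have hb0 : b ≠ 0 := hb ▸ algebraMap_ne_zero_of_eval ![0, 1, 0] (by simp)
  have hc0 : c ≠ 0 := hc ▸ algebraMap_ne_zero_of_eval ![0, 0, 1] (by simp)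
  have h27 : (27 : K) ≠ 0 := by
    convert pow_ne_zero 3 h3 using 1
    norm_num
  have hab : b - a ≠ 0 := by
    rw [ha, hb, ← map_sub]
    exact algebraMap_ne_zero_of_eval ![0, 1, 0] (by simp)
  have hc1 : c ^ 2 + 1 ≠ 0 := by
    have h : algebraMap (MvPolynomial (Fin 3) K) L (MvPolynomial.X 2 ^ 2 + 1) ≠ 0 :=
      algebraMap_ne_zero_of_eval ![0, 0, 0] (by simp)
    simpa only [hc, map_add, map_pow, map_one] using h
  have hac : 4 * (a + c) ^ 3 + 27 * a ≠ 0 := by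
    have h : algebraMap (MvPolynomial (Fin 3) K) L
        (4 * (MvPolynomial.X 0 + MvPolynomial.X 2) ^ 3 + 27 * MvPolynomial.X 0) ≠ 0 :=
      algebraMap_ne_zero_of_eval ![1, 0, -1] (by simpa using h27)
    simpa only [ha, hc, map_add, map_mul, map_pow, map_ofNat] using h
  have hbc : 4 * (b + c) ^ 3 + 27 * b ≠ 0 := by
    have h : algebraMap (MvPolynomial (Fin 3) K) L
        (4 * (MvPolynomial.X 1 + MvPolynomial.X 2) ^ 3 + 27 * MvPolynomial.X 1) ≠ 0 :=
      algebraMap_ne_zero_of_eval ![0, 1, -1] (by simpa using h27)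
    simpa only [hb, hc, map_add, map_mul, map_pow, map_ofNat] using h
  have h2' : (2 : L) ≠ 0 := by
    rw [← map_ofNat (algebraMap (MvPolynomial (Fin 3) K) L) 2]
    exact algebraMap_ne_zero_of_eval 0 (by simpa only [map_ofNat] using h2)
  have h3' : (3 : L) ≠ 0 := by
    rw [← map_ofNat (algebraMap (MvPolynomial (Fin 3) K) L) 3]
    exact algebraMap_ne_zero_of_eval 0 (by simpa only [map_ofNat] using h3)
  have hk : -2 ^ 12 * a ^ 9 * b ^ 9 ≠ 0 := by simp [ha0, hb0, h2']
  have hu : IsUnit (C (-2 ^ 12 * a ^ 9 * b ^ 9)) := isUnit_C.2 hk.isUnit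
  rw [hf, degree_C_mul hk, derivative_C_mul]
  exact ⟨degree_reducedDisc hc0 hab, (isCoprime_mul_unit_left hu _ _).2
    (isCoprime_derivative_reducedDisc h2' h3' ha0 hb0 hc0 hab hc1 hac hbc)⟩

end GenericPoint

/-- For `K` algebraically closed with `char K ∉ {2,3}`, the discriminant
`Δ(s) = −16(4A(s)³ + 27B(s)²) ∈ L[s]` of the generic member of the family `E_{a,b,c}`
has degree exactly `24` and is squarefree, i.e. `Δ` and `Δ'` are coprime in `L[s]`:
the generic elliptic surface has exactly `24` singular fibers, all of type `I₁`. -/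
theorem kuwata_discriminant_degree_and_squarefree (K : Type) [Field K] [IsAlgClosed K]
    (h2 : (2 : K) ≠ 0) (h3 : (3 : K) ≠ 0) :
    (-16 * (4 * kuwataA K ^ 3 + 27 * kuwataB K ^ 2)).degree = 24 ∧
    IsCoprime (-16 * (4 * kuwataA K ^ 3 + 27 * kuwataB K ^ 2))
      (derivative (-16 * (4 * kuwataA K ^ 3 + 27 * kuwataB K ^ 2))) := by
  refine degree_and_isCoprime_of_generic h2 h3 rfl rfl rfl ?_
  simp only [kuwataA, kuwataB, reducedDisc, octicP, octicQ, map_add, map_sub, map_mul, map_neg,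
    map_pow, map_ofNat]
  ring
end

section
/- Let z ∈ ℂ be any root of the polynomial 83521·X⁴ + 4913·X³ + 136·X² + 17·X + 1. Then 1/(17z) is not a root of unity, i.e., for every integer n ≥ 1, (1/(17z))ⁿ ≠ 1. -/
/-- No reciprocal root of `G̃₁₇ = 1 + 17X + 136X² + 4913X³ + 83521X⁴`, the degree-4
factor of the characteristic polynomial of Frobenius of `𝔽₁₇` on `H²_ét` of the
reduction mod `17` of `y² = x³ − (2t−1)³(4t−1)²x + t(2t−1)³(4t−1)³`, is of the form
`17ζ` with `ζ` a root of unity: if `z` is a root then `1/(17z)` is not a root of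
unity. -/
theorem kuwata_frobenius_factor_17_no_root_of_unity (z : ℂ)
    (hz : 83521 * z ^ 4 + 4913 * z ^ 3 + 136 * z ^ 2 + 17 * z + 1 = 0) :
    ∀ n : ℕ, 1 ≤ n → (1 / (17 * z)) ^ n ≠ 1 := by
  intro n hn h
  have hz0 : z ≠ 0 := by rintro rfl; norm_num at hz
  have hu : IsIntegral ℤ (1 / (17 * z)) := IsIntegral.of_pow hn (by rw [h]; exact isIntegral_one)
  have hv : IsIntegral ℤ (17 * z) := by
    refine IsIntegral.of_pow hn ?_
    rw [one_div, inv_pow, inv_eq_one] at h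
    rw [h]
    exact isIntegral_one
  have key : algebraMap ℚ ℂ (8 / 17) =
      -((17 * z) ^ 4 + (17 * z) ^ 3 + 17 * z + 1) * (1 / (17 * z)) ^ 2 := by
    simp only [map_div₀, map_ofNat]
    field_simp
    linear_combination hz
  have hint : IsIntegral ℤ (algebraMap ℚ ℂ (8 / 17)) :=
    key ▸ ((((hv.pow 4).add (hv.pow 3)).add hv).add isIntegral_one).neg.mul (hu.pow 2)
  rw [isIntegral_algebraMap_iff (algebraMap ℚ ℂ).injective] at hint
  obtain ⟨m, hm⟩ := IsIntegrallyClosed.isIntegral_iff.mp hint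
  have hm' : (m : ℚ) * 17 = 8 := by
    rw [eq_intCast] at hm
    rw [hm]
    norm_num
  norm_cast at hm'
  omega
end

section
/- Let z ∈ ℂ be any root of the polynomial 130321·X⁴ − 3249·X³ − 228·X² − 9·X + 1. Then 1/(19z) is not a root of unity; that is, for every integer n ≥ 1, (1/(19z))ⁿ ≠ 1. -/
open Polynomial in
/-- No complex root of `19X² - 9X - 50` is an algebraic integer. -/
theorem not_isIntegral_of_quadratic {w : ℂ} (hw : 19 * w ^ 2 - 9 * w - 50 = 0) :
    ¬ IsIntegral ℤ w := by
  intro hint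
  have hmonic := minpoly.monic hint
  have hpos := minpoly.natDegree_pos hint
  obtain ⟨q, hq⟩ : minpoly ℤ w ∣ C 19 * X ^ 2 + C (-9) * X + C (-50) :=
    minpoly.isIntegrallyClosed_dvd hint (by
      simp only [map_add, map_mul, map_pow, aeval_X, aeval_C, algebraMap_int_eq, Int.coe_castRingHom]
      push_cast
      linear_combination hw)
  generalize minpoly ℤ w = P at *
  have hdeg : (C (19 : ℤ) * X ^ 2 + C (-9) * X + C (-50)).natDegree = 2 :=
    natDegree_quadratic (by norm_num)
  have hq0 : q ≠ 0 := by
    rintro rfl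
    rw [hq, mul_zero, natDegree_zero] at hdeg
    omega
  have hsum : P.natDegree + q.natDegree = 2 := by
    rw [← hmonic.natDegree_mul' hq0, ← hq, hdeg]
  obtain h | h : P.natDegree = 1 ∨ P.natDegree = 2 := by omega
  · have hroot := congrArg (eval (-P.coeff 0)) hq
    rw [eval_mul, hmonic.eq_X_add_C h] at hroot
    simp only [eval_add, eval_mul, eval_C, eval_pow, eval_X, coeff_add, coeff_X_zero,
      coeff_C_zero, zero_add, neg_add_cancel, zero_mul] at hroot
    generalize P.coeff 0 = a at hroot
    have hlo : -3 ≤ a := by nlinarith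
    have hhi : a ≤ 3 := by nlinarith
    interval_cases a <;> omega
  · rw [eq_C_of_natDegree_eq_zero (p := q) (by omega)] at hq
    have hlead : P.coeff 2 = 1 := h ▸ hmonic.coeff_natDegree
    have h2 := congrArg (coeff · 2) hq
    have h1 := congrArg (coeff · 1) hq
    simp [coeff_X, hlead] at h1 h2
    rw [← h2] at h1
    omega

/-- No reciprocal root of `G̃₁₉ = 1 − 9X − 228X² − 3249X³ + 130321X⁴`, the degree-4
factor of the characteristic polynomial of Frobenius of `𝔽₁₉` on `H²_ét` of the
reduction mod `19` of `y² = x³ − (2t−1)³(4t−1)²x + t(2t−1)³(4t−1)³`, is of the form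
`19ζ` with `ζ` a root of unity: if `z` is a root then `1/(19z)` is not a root of
unity. -/
theorem kuwata_frobenius_factor_19_no_root_of_unity (z : ℂ)
    (hz : 130321 * z ^ 4 - 3249 * z ^ 3 - 228 * z ^ 2 - 9 * z + 1 = 0) :
    ∀ n : ℕ, 1 ≤ n → (1 / (19 * z)) ^ n ≠ 1 := by
  intro n hn hu
  have hz0 : z ≠ 0 := by
    rintro rfl
    norm_num at hz
  have hu' : (19 * z) ^ n = 1 := by
    rwa [one_div, inv_pow, inv_eq_one] at hu
  have hint : IsIntegral ℤ (1 / (19 * z) + 19 * z) :=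
    (IsIntegral.of_pow hn (by rw [hu]; exact isIntegral_one)).add
      (IsIntegral.of_pow hn (by rw [hu']; exact isIntegral_one))
  refine not_isIntegral_of_quadratic ?_ hint
  field_simp
  linear_combination hz
end
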